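/- arXiv:1810.02875 — 3 statements merged into one kernel-verified Lean document; each statement's English description precedes it below -/
import Mathlib

section
/- Let n ≥ 3. For the flower graph F_n, the minimum first chromatic Zagreb index satisfies M₁^{φ−}(F_n) = 5n + 9 if n is even, and M₁^{φ−}(F_n) = 5n + 21 if n is odd. -/
open Finset

/-- Vertex type: `none` is the center `u`; `some (Sum.inl i)` is `uᵢ`;
`some (Sum.inr i)` is `vᵢ`. -/
abbrev GV (n : ℕ) : Type := Option (Fin n ⊕ Fin n)

/-- `j = i + 1 (mod n)`: `j` is the cyclic successor of `i` in `Fin n`. -/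
def NextIdx {n : ℕ} (i j : Fin n) : Prop := (j : ℕ) = ((i : ℕ) + 1) % n

/-- The flower graph `F_n`: edges `uᵢu_{i+1}` (indices mod `n`), `u uᵢ`,
`uᵢvᵢ` and `u vᵢ` for all `i`. -/
def flowerGraph (n : ℕ) : SimpleGraph (GV n) :=
  SimpleGraph.fromRel (fun a b =>
    (∃ i j : Fin n, NextIdx i j ∧ a = some (Sum.inl i) ∧ b = some (Sum.inl j)) ∨
    (∃ i : Fin n, a = none ∧ b = some (Sum.inl i)) ∨
    (∃ i : Fin n, a = some (Sum.inl i) ∧ b = some (Sum.inr i)) ∨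
    (∃ i : Fin n, a = none ∧ b = some (Sum.inr i)))

/-- `ζ` is a proper vertex coloring of `G` using the colors `{1, …, k}`:
every vertex gets a color in `{1, …, k}` and adjacent vertices get
different colors. -/
def IsProperColoring {V : Type} (G : SimpleGraph V) (k : ℕ) (ζ : V → ℕ) : Prop :=
  (∀ v, 1 ≤ ζ v ∧ ζ v ≤ k) ∧ ∀ ⦃a b⦄, G.Adj a b → ζ a ≠ ζ b

/-- The chromatic number of `G`, as a natural number. -/
noncomputable def chi {V : Type} (G : SimpleGraph V) : ℕ := G.chromaticNumber.toNat

/-- The first chromatic Zagreb index: `∑_{v ∈ V(G)} ζ(v)²`. -/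
def M1 {V : Type} [Fintype V] (ζ : V → ℕ) : ℚ := ∑ v, (ζ v : ℚ) ^ 2

theorem NextIdx.eq_or {n : ℕ} {i j : Fin n} (h : NextIdx i j) :
    (j : ℕ) = i + 1 ∨ ((i : ℕ) + 1 = n ∧ (j : ℕ) = 0) := by
  unfold NextIdx at h
  rcases Nat.lt_or_ge ((i : ℕ) + 1) n with hi | hi
  · exact Or.inl (by rwa [Nat.mod_eq_of_lt hi] at h)
  · have hi' : (i : ℕ) + 1 = n := by omega
    exact Or.inr ⟨hi', by rwa [hi', Nat.mod_self] at h⟩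

theorem isProperColoring_flowerGraph_iff {n k : ℕ} (hn : 2 ≤ n) (ζ : GV n → ℕ) :
    IsProperColoring (flowerGraph n) k ζ ↔
      (∀ v, 1 ≤ ζ v ∧ ζ v ≤ k) ∧
      (∀ i, ζ none ≠ ζ (some (Sum.inl i))) ∧
      (∀ i, ζ none ≠ ζ (some (Sum.inr i))) ∧
      (∀ i, ζ (some (Sum.inl i)) ≠ ζ (some (Sum.inr i))) ∧
      ∀ i j, NextIdx i j → ζ (some (Sum.inl i)) ≠ ζ (some (Sum.inl j)) := by
  refine and_congr_right fun _ => ⟨fun h => ⟨fun i => h ?_, fun i => h ?_, fun i => h ?_,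
    fun i j hij => h ?_⟩, ?_⟩
  · simp [flowerGraph]
  · simp [flowerGraph]
  · simp [flowerGraph]
  · have hne : i ≠ j := by
      rintro rfl
      have := hij.eq_or
      omega
    simp [flowerGraph, hne, hij]
  · rintro ⟨h₁, h₂, h₃, h₄⟩ a b hab
    rw [flowerGraph, SimpleGraph.fromRel_adj] at hab
    rcases hab.2 with
      (⟨i, j, h, rfl, rfl⟩ | ⟨i, rfl, rfl⟩ | ⟨i, rfl, rfl⟩ | ⟨i, rfl, rfl⟩) |
      (⟨i, j, h, rfl, rfl⟩ | ⟨i, rfl, rfl⟩ | ⟨i, rfl, rfl⟩ | ⟨i, rfl, rfl⟩)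
    exacts [h₄ i j h, h₁ i, h₃ i, h₂ i, (h₄ i j h).symm, (h₁ i).symm, (h₃ i).symm, (h₂ i).symm]

theorem colorable_iff_exists_isProperColoring {V : Type} (G : SimpleGraph V) (k : ℕ) :
    G.Colorable k ↔ ∃ ζ, IsProperColoring G k ζ := by
  constructor
  · rintro ⟨C⟩
    refine ⟨fun v => (C v : ℕ) + 1, fun v => ⟨Nat.le_add_left 1 _, (C v).isLt⟩, fun a b hab h => ?_⟩
    exact C.valid hab (Fin.ext (by simpa using h))
  · rintro ⟨ζ, hζ, hadj⟩
    refine ⟨SimpleGraph.Coloring.mk (fun v => ⟨ζ v - 1, by have := hζ v; omega⟩) ?_⟩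
    intro a b hab h
    have := hadj hab
    have := hζ a
    have := hζ b
    simp only [Fin.mk.injEq] at h
    omega

theorem chi_eq_succ {V : Type} {G : SimpleGraph V} {k : ℕ} {ζ : V → ℕ}
    (hζ : IsProperColoring G (k + 1) ζ) (h : ∀ ξ, ¬ IsProperColoring G k ξ) :
    chi G = k + 1 := by
  have hle : G.chromaticNumber ≤ (k + 1 : ℕ) :=
    ((colorable_iff_exists_isProperColoring G (k + 1)).2 ⟨ζ, hζ⟩).chromaticNumber_le
  have hlt : ¬ G.chromaticNumber ≤ (k : ℕ) := fun hk => by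
    obtain ⟨ξ, hξ⟩ := (colorable_iff_exists_isProperColoring G k).1
      (SimpleGraph.chromaticNumber_le_iff_colorable.1 hk)
    exact h ξ hξ
  unfold chi
  lift G.chromaticNumber to ℕ using ne_top_of_le_ne_top (ENat.natCast_ne_top _) hle with m
  rw [Nat.cast_le] at hle hlt
  rw [ENat.toNat_natCast]
  omega

/-- An odd cycle cannot alternate between membership and non-membership. -/
theorem exists_nextIdx_iff_of_odd {n : ℕ} (hn : Odd n) (p : Fin n → Prop) :
    ∃ i j, NextIdx i j ∧ (p i ↔ p j) := by
  by_contra! h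
  have hpos := hn.pos
  have key : ∀ k (hk : k < n), p ⟨k, hk⟩ ↔ (p ⟨0, hpos⟩ ↔ Even k) := by
    intro k
    induction k with
    | zero => simp
    | succ k ih =>
      intro hk
      have h₁ := ih (by omega)
      have h₂ := h ⟨k, by omega⟩ ⟨k + 1, hk⟩ (Nat.mod_eq_of_lt hk).symm
      rw [Nat.even_add_one]
      tauto
  have h₁ := key (n - 1) (by omega)
  have h₂ := h ⟨n - 1, by omega⟩ ⟨0, hpos⟩ (by simp [NextIdx, Nat.sub_add_cancel hpos])
  have h₃ : Even (n - 1) := hn.tsub_odd odd_one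
  tauto

/-- In a proper coloring of an odd cycle, some two consecutive vertices avoid the color `a`. -/
theorem exists_nextIdx_ne_of_odd {n : ℕ} (hn : Odd n) {f : Fin n → ℕ}
    (hf : ∀ i j, NextIdx i j → f i ≠ f j) (a : ℕ) :
    ∃ i j, f i ≠ a ∧ f j ≠ a ∧ f i ≠ f j := by
  obtain ⟨i, j, hij, h⟩ := exists_nextIdx_iff_of_odd hn (fun i => f i = a)
  have := hf i j hij
  exact ⟨i, j, by grind⟩

theorem not_isProperColoring_two {n : ℕ} (hn : 2 ≤ n) (ζ : GV n → ℕ) :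
    ¬ IsProperColoring (flowerGraph n) 2 ζ := by
  rw [isProperColoring_flowerGraph_iff hn]
  rintro ⟨hb, h₁, h₂, h₃, -⟩
  let i : Fin n := ⟨0, by omega⟩
  have := hb none
  have := hb (some (Sum.inl i))
  have := hb (some (Sum.inr i))
  have := h₁ i
  have := h₂ i
  have := h₃ i
  omega

theorem not_isProperColoring_three {n : ℕ} (hn : 2 ≤ n) (hodd : Odd n) (ζ : GV n → ℕ) :
    ¬ IsProperColoring (flowerGraph n) 3 ζ := by
  rw [isProperColoring_flowerGraph_iff hn]
  rintro ⟨hb, h₁, -, -, h₄⟩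
  obtain ⟨a, ha, ha', hac⟩ : ∃ a, 1 ≤ a ∧ a ≤ 3 ∧ a ≠ ζ none := by
    by_cases h : ζ none = 1
    · exact ⟨2, by omega⟩
    · exact ⟨1, by omega⟩
  obtain ⟨i, j, hi, hj, hij⟩ := exists_nextIdx_ne_of_odd hodd h₄ a
  have := hb none
  have := hb (some (Sum.inl i))
  have := hb (some (Sum.inl j))
  have := h₁ i
  have := h₁ j
  omega

theorem M1_eq_natCast {n : ℕ} (ζ : GV n → ℕ) :
    M1 ζ = ((ζ none ^ 2 + ∑ i : Fin n,
      (ζ (some (Sum.inl i)) ^ 2 + ζ (some (Sum.inr i)) ^ 2) : ℕ) : ℚ) := by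
  simp [M1, Fintype.sum_option, Fintype.sum_sum_type, Finset.sum_add_distrib]

theorem mul_le_sum_fin {n a : ℕ} {f : Fin n → ℕ} (h : ∀ i, a ≤ f i) : a * n ≤ ∑ i, f i := by
  simpa [mul_comm] using Finset.card_nsmul_le_sum univ f a fun i _ => h i

theorem mul_add_le_sum_fin_add {n a b : ℕ} {f : Fin n → ℕ} (h : ∀ i, a ≤ f i) {i₀ : Fin n}
    (h₀ : b ≤ f i₀) : a * n + b ≤ ∑ i, f i + a := by
  have h₁ := Finset.card_nsmul_le_sum (univ.erase i₀) f a fun i _ => h i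
  have h₂ := Finset.add_sum_erase univ f (mem_univ i₀)
  rw [Finset.card_erase_of_mem (mem_univ i₀), Finset.card_univ, Fintype.card_fin, smul_eq_mul] at h₁
  have h₃ : a * n = (n - 1) * a + a := by
    rw [← Nat.succ_mul, Nat.succ_eq_add_one, Nat.sub_add_cancel i₀.pos, mul_comm]
  linarith

/-- The coloring with `u ↦ c`, `uᵢ ↦ f i` and `vᵢ ↦ g i`. -/
def flowerColoring {n : ℕ} (c : ℕ) (f g : Fin n → ℕ) : GV n → ℕ
  | none => c
  | some (Sum.inl i) => f i
  | some (Sum.inr i) => g i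

/-- The coloring of an even flower whose rim alternates between `1` and `2`. -/
def evenFlowerColoring (n : ℕ) : GV n → ℕ :=
  flowerColoring 3 (fun i => if (i : ℕ) % 2 = 0 then 1 else 2)
    (fun i => if (i : ℕ) % 2 = 0 then 2 else 1)

/-- The coloring of an odd flower whose rim alternates between `1` and `2`, except for a single
vertex of color `3`. -/
def oddFlowerColoring (n : ℕ) : GV n → ℕ :=
  flowerColoring 4
    (fun i => if (i : ℕ) + 1 = n then 3 else if (i : ℕ) % 2 = 0 then 1 else 2)
    (fun i => if (i : ℕ) + 1 = n then 1 else if (i : ℕ) % 2 = 0 then 2 else 1)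

theorem isProperColoring_evenFlowerColoring {n : ℕ} (hn : 2 ≤ n) (heven : Even n) :
    IsProperColoring (flowerGraph n) 3 (evenFlowerColoring n) := by
  rw [isProperColoring_flowerGraph_iff hn]
  rw [Nat.even_iff] at heven
  refine ⟨?_, fun i => ?_, fun i => ?_, fun i => ?_, fun i j hij => ?_⟩
  · rintro (_ | i | i) <;> simp only [evenFlowerColoring, flowerColoring] <;>
      (try split_ifs) <;> omega
  · simp only [evenFlowerColoring, flowerColoring]; split_ifs <;> omega
  · simp only [evenFlowerColoring, flowerColoring]; split_ifs <;> omega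
  · simp only [evenFlowerColoring, flowerColoring]; split_ifs <;> omega
  · have := hij.eq_or
    simp only [evenFlowerColoring, flowerColoring]; split_ifs <;> omega

theorem isProperColoring_oddFlowerColoring {n : ℕ} (hn : 2 ≤ n) (hodd : Odd n) :
    IsProperColoring (flowerGraph n) 4 (oddFlowerColoring n) := by
  rw [isProperColoring_flowerGraph_iff hn]
  rw [Nat.odd_iff] at hodd
  refine ⟨?_, fun i => ?_, fun i => ?_, fun i => ?_, fun i j hij => ?_⟩
  · rintro (_ | i | i) <;> simp only [oddFlowerColoring, flowerColoring] <;>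
      (try split_ifs) <;> omega
  · simp only [oddFlowerColoring, flowerColoring]; split_ifs <;> omega
  · simp only [oddFlowerColoring, flowerColoring]; split_ifs <;> omega
  · simp only [oddFlowerColoring, flowerColoring]; split_ifs <;> omega
  · have := hij.eq_or
    simp only [oddFlowerColoring, flowerColoring]; split_ifs <;> omega

theorem M1_evenFlowerColoring (n : ℕ) : M1 (evenFlowerColoring n) = 5 * n + 9 := by
  have h : ∀ i : Fin n, evenFlowerColoring n (some (Sum.inl i)) ^ 2 +
      evenFlowerColoring n (some (Sum.inr i)) ^ 2 = 5 := fun i => by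
    simp only [evenFlowerColoring, flowerColoring]; split_ifs <;> norm_num
  rw [M1_eq_natCast]
  simp only [h]
  simp [evenFlowerColoring, flowerColoring]
  ring

theorem M1_oddFlowerColoring {n : ℕ} (hn : 1 ≤ n) :
    M1 (oddFlowerColoring n) = 5 * n + 21 := by
  have h : ∀ i : Fin n, oddFlowerColoring n (some (Sum.inl i)) ^ 2 +
      oddFlowerColoring n (some (Sum.inr i)) ^ 2 =
        5 + if i = ⟨n - 1, by omega⟩ then 5 else 0 := fun i => by
    simp only [oddFlowerColoring, flowerColoring, Fin.ext_iff]
    split_ifs <;> omega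
  rw [M1_eq_natCast]
  simp only [h, Finset.sum_add_distrib]
  simp [oddFlowerColoring, flowerColoring]
  ring

theorem le_M1_of_isProperColoring_three {n : ℕ} (hn : 2 ≤ n) {ζ : GV n → ℕ}
    (hζ : IsProperColoring (flowerGraph n) 3 ζ) : 5 * (n : ℚ) + 9 ≤ M1 ζ := by
  rw [isProperColoring_flowerGraph_iff hn] at hζ
  obtain ⟨hb, h₁, h₂, h₃, -⟩ := hζ
  rw [M1_eq_natCast]
  norm_cast
  have hpair (i : Fin n) := And.intro (hb (some (Sum.inl i)))
    (And.intro (hb (some (Sum.inr i))) (And.intro (h₁ i) (And.intro (h₂ i) (h₃ i))))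
  have hc := hb none
  generalize ζ none = c at *
  obtain rfl | hc' : c = 3 ∨ c ≤ 2 := by omega
  · have := mul_le_sum_fin (a := 5)
      (f := fun i => ζ (some (Sum.inl i)) ^ 2 + ζ (some (Sum.inr i)) ^ 2) fun i => by
        have := hpair i
        generalize ζ (some (Sum.inl i)) = x at *
        generalize ζ (some (Sum.inr i)) = y at *
        obtain ⟨⟨_, _⟩, ⟨_, _⟩, _⟩ := this
        interval_cases x <;> interval_cases y <;> omega
    omega
  · have := mul_le_sum_fin (a := 10)
      (f := fun i => ζ (some (Sum.inl i)) ^ 2 + ζ (some (Sum.inr i)) ^ 2) fun i => by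
        have := hpair i
        generalize ζ (some (Sum.inl i)) = x at *
        generalize ζ (some (Sum.inr i)) = y at *
        obtain ⟨⟨_, _⟩, ⟨_, _⟩, _⟩ := this
        interval_cases x <;> interval_cases y <;> omega
    nlinarith

/-- Let `c` be the color of the center. If all pairs of distinct colors from `{1, …, k}` other than
`c` have square sum at least `a`, and each such pair avoiding `1` contains a color at least `m`,
then in an odd flower some petal has square sum at least `m ^ 2 + 1`, and all others at least `a`. -/
theorem mul_add_le_sum_petals {n k : ℕ} (hn : 2 ≤ n) (hodd : Odd n) {ζ : GV n → ℕ}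
    (hζ : IsProperColoring (flowerGraph n) k ζ) (a m : ℕ)
    (ha : ∀ x ∈ Icc 1 k, ∀ y ∈ Icc 1 k, ζ none ≠ x → ζ none ≠ y → x ≠ y → a ≤ x ^ 2 + y ^ 2)
    (hm : ∀ x ∈ Icc 1 k, ∀ y ∈ Icc 1 k, ζ none ≠ x → ζ none ≠ y → x ≠ y → x ≠ 1 → y ≠ 1 →
      m ≤ x ∨ m ≤ y) :
    a * n + (m ^ 2 + 1) ≤
      ∑ i : Fin n, (ζ (some (Sum.inl i)) ^ 2 + ζ (some (Sum.inr i)) ^ 2) + a := by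
  rw [isProperColoring_flowerGraph_iff hn] at hζ
  obtain ⟨hb, h₁, h₂, h₃, h₄⟩ := hζ
  have hb' (v) : ζ v ∈ Icc 1 k := mem_Icc.2 (hb v)
  have hpetal (i : Fin n) (h : m ≤ ζ (some (Sum.inl i))) :
      m ^ 2 + 1 ≤ ζ (some (Sum.inl i)) ^ 2 + ζ (some (Sum.inr i)) ^ 2 :=
    Nat.add_le_add (Nat.pow_le_pow_left h 2) (Nat.one_le_pow _ _ (hb _).1)
  have hall (i : Fin n) := ha _ (hb' _) _ (hb' _) (h₁ i) (h₂ i) (h₃ i)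
  obtain ⟨i, j, hi, hj, hij⟩ := exists_nextIdx_ne_of_odd hodd h₄ 1
  rcases hm _ (hb' _) _ (hb' _) (h₁ i) (h₁ j) hij hi hj with h | h
  · exact mul_add_le_sum_fin_add hall (hpetal i h)
  · exact mul_add_le_sum_fin_add hall (hpetal j h)

theorem le_M1_of_isProperColoring_four {n : ℕ} (hn : 3 ≤ n) (hodd : Odd n) {ζ : GV n → ℕ}
    (hζ : IsProperColoring (flowerGraph n) 4 ζ) : 5 * (n : ℚ) + 21 ≤ M1 ζ := by
  have hsum := mul_add_le_sum_petals (by omega) hodd hζ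
  have hc := hζ.1 none
  rw [M1_eq_natCast]
  norm_cast
  generalize ζ none = c at *
  obtain rfl | rfl | rfl | rfl : c = 1 ∨ c = 2 ∨ c = 3 ∨ c = 4 := by omega
  · have := hsum 13 3 (by decide) (by decide)
    omega
  · have := hsum 10 4 (by decide) (by decide)
    omega
  · have := hsum 5 4 (by decide) (by decide)
    omega
  · have := hsum 5 3 (by decide) (by decide)
    omega

theorem flower_M1_min (n : ℕ) (hn : 3 ≤ n) :
    (Even n → IsLeast {x : ℚ | ∃ ζ : GV n → ℕ,
        IsProperColoring (flowerGraph n) (chi (flowerGraph n)) ζ ∧ x = M1 ζ}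
      (5 * (n : ℚ) + 9)) ∧
    (Odd n → IsLeast {x : ℚ | ∃ ζ : GV n → ℕ,
        IsProperColoring (flowerGraph n) (chi (flowerGraph n)) ζ ∧ x = M1 ζ}
      (5 * (n : ℚ) + 21)) := by
  refine ⟨fun heven => ?_, fun hodd => ?_⟩
  · have hζ := isProperColoring_evenFlowerColoring (by omega) heven
    rw [chi_eq_succ hζ (not_isProperColoring_two (by omega))]
    refine ⟨⟨_, hζ, (M1_evenFlowerColoring n).symm⟩, ?_⟩
    rintro _ ⟨ξ, hξ, rfl⟩
    exact le_M1_of_isProperColoring_three (by omega) hξ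
  · have hζ := isProperColoring_oddFlowerColoring (by omega) hodd
    rw [chi_eq_succ hζ (not_isProperColoring_three (by omega) hodd)]
    refine ⟨⟨_, hζ, (M1_oddFlowerColoring (by omega)).symm⟩, ?_⟩
    rintro _ ⟨ξ, hξ, rfl⟩
    exact le_M1_of_isProperColoring_four hn hodd hξ
end

section
/- Let n ≥ 3. For the sunflower graph SF_n, the minimum first chromatic Zagreb index satisfies M₁^{φ−}(SF_n) = (15n + 2)/2 if n is even, and M₁^{φ−}(SF_n) = (15n + 21)/2 if n is odd. -/
open Finset

/-- The sunflower graph `SF_n`: edges `uᵢu_{i+1}` (indices mod `n`), `u uᵢ`,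
`vᵢuᵢ` and `vᵢu_{i+1}` for all `i`. -/
def sunflowerGraph (n : ℕ) : SimpleGraph (GV n) :=
  SimpleGraph.fromRel (fun a b =>
    (∃ i j : Fin n, NextIdx i j ∧ a = some (Sum.inl i) ∧ b = some (Sum.inl j)) ∨
    (∃ i : Fin n, a = none ∧ b = some (Sum.inl i)) ∨
    (∃ i : Fin n, a = some (Sum.inr i) ∧ b = some (Sum.inl i)) ∨
    (∃ i j : Fin n, NextIdx i j ∧ a = some (Sum.inr i) ∧ b = some (Sum.inl j)))

theorem nextIdx_iff {n : ℕ} [NeZero n] (i j : Fin n) : NextIdx i j ↔ j = i + 1 := by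
  rw [NextIdx, Fin.ext_iff, Fin.val_add, Fin.val_one', Nat.add_mod_mod]

/-- A map on the vertices of the sunflower graph separates adjacent vertices iff it does so on each
spoke `u uᵢ` and on each triangle `uᵢ u_{i+1} vᵢ`. -/
theorem sunflowerGraph_ne_iff {n : ℕ} [NeZero n] (hn : 2 ≤ n) {α : Type} (f : GV n → α) :
    (∀ ⦃a b⦄, (sunflowerGraph n).Adj a b → f a ≠ f b) ↔
      ∀ i : Fin n, f none ≠ f (some (Sum.inl i)) ∧
        f (some (Sum.inl i)) ≠ f (some (Sum.inl (i + 1))) ∧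
        f (some (Sum.inr i)) ≠ f (some (Sum.inl i)) ∧
        f (some (Sum.inr i)) ≠ f (some (Sum.inl (i + 1))) := by
  simp only [sunflowerGraph, SimpleGraph.fromRel_adj, nextIdx_iff]
  constructor
  · intro h i
    have hi : i ≠ i + 1 := by
      intro e
      have h1 : (1 : Fin n) = 0 := by simpa using e.symm
      have h2 := congrArg Fin.val h1
      rw [Fin.val_one', Nat.mod_eq_of_lt (by omega), Fin.val_zero] at h2
      omega
    refine ⟨h ⟨by simp, Or.inl (Or.inr (Or.inl ⟨i, rfl, rfl⟩))⟩,
      h ⟨by simpa using hi, Or.inl (Or.inl ⟨i, i + 1, rfl, rfl, rfl⟩)⟩,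
      h ⟨by simp, Or.inl (Or.inr (Or.inr (Or.inl ⟨i, rfl, rfl⟩)))⟩,
      h ⟨by simp, Or.inl (Or.inr (Or.inr (Or.inr ⟨i, i + 1, rfl, rfl, rfl⟩)))⟩⟩
  · rintro h a b ⟨-, (⟨i, j, rfl, rfl, rfl⟩ | ⟨i, rfl, rfl⟩ | ⟨i, rfl, rfl⟩ | ⟨i, j, rfl, rfl, rfl⟩) |
      (⟨i, j, rfl, rfl, rfl⟩ | ⟨i, rfl, rfl⟩ | ⟨i, rfl, rfl⟩ | ⟨i, j, rfl, rfl, rfl⟩)⟩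
    · exact (h i).2.1
    · exact (h i).1
    · exact (h i).2.2.1
    · exact (h i).2.2.2
    · exact (h i).2.1.symm
    · exact (h i).1.symm
    · exact (h i).2.2.1.symm
    · exact (h i).2.2.2.symm

theorem sum_add_one {n : ℕ} [NeZero n] (g : Fin n → ℕ) : ∑ i, g (i + 1) = ∑ i, g i :=
  Equiv.sum_comp (Equiv.addRight (1 : Fin n)) g

/-- A color class of a proper coloring of a cycle contains at most half of the vertices. -/
theorem two_mul_sum_ite_le {n : ℕ} [NeZero n] (c : Fin n → ℕ) (hc : ∀ i, c i ≠ c (i + 1)) (x : ℕ) :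
    2 * ∑ i, (if c i = x then 1 else 0) ≤ n := by
  have h : ∑ i, ((if c i = x then 1 else 0) + (if c (i + 1) = x then 1 else 0)) ≤
      ∑ _i : Fin n, 1 := by
    refine Finset.sum_le_sum fun i _ => ?_
    have := hc i
    split_ifs <;> omega
  rw [Finset.sum_add_distrib, sum_add_one (fun i => if c i = x then 1 else 0)] at h
  simp only [Finset.sum_const, Finset.card_univ, Fintype.card_fin, smul_eq_mul, mul_one] at h
  omega

theorem sunflowerGraph_not_colorable_two {n : ℕ} (hn : 3 ≤ n) :
    ¬ (sunflowerGraph n).Colorable 2 := by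
  have : NeZero n := ⟨by omega⟩
  rintro ⟨C⟩
  have h := (sunflowerGraph_ne_iff (by omega) C).1 (fun a b hab => C.valid hab)
  have h0 := h 0
  have h1 := (h (0 + 1)).1
  simp only [ne_eq, Fin.ext_iff] at h0 h1
  omega

theorem sunflowerGraph_not_colorable_three {n : ℕ} (hn : 3 ≤ n) (ho : Odd n) :
    ¬ (sunflowerGraph n).Colorable 3 := by
  have : NeZero n := ⟨by omega⟩
  rintro ⟨C⟩
  have h := (sunflowerGraph_ne_iff (by omega) C).1 (fun a b hab => C.valid hab)
  simp only [ne_eq, Fin.ext_iff] at h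
  set c : Fin n → ℕ := fun i => (C (some (Sum.inl i))).val with hc
  have key := two_mul_sum_ite_le c (fun i => (h i).2.1)
  obtain ⟨x, y, hxy⟩ : ∃ x y : ℕ, ∀ i, c i = x ∨ c i = y := by
    have hu := (C none).isLt
    obtain e | e | e : (C none).val = 0 ∨ (C none).val = 1 ∨ (C none).val = 2 := by omega
    · exact ⟨1, 2, fun i => by have := (h i).1; simp only [hc]; omega⟩
    · exact ⟨0, 2, fun i => by have := (h i).1; simp only [hc]; omega⟩
    · exact ⟨0, 1, fun i => by have := (h i).1; simp only [hc]; omega⟩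
  have hs : ∑ _i : Fin n, 1 ≤
      ∑ i, ((if c i = x then 1 else 0) + (if c i = y then 1 else 0)) := by
    refine Finset.sum_le_sum fun i _ => ?_
    have := hxy i
    split_ifs <;> omega
  rw [Finset.sum_add_distrib] at hs
  simp only [Finset.sum_const, Finset.card_univ, Fintype.card_fin, smul_eq_mul, mul_one] at hs
  have := key x
  have := key y
  obtain ⟨m, rfl⟩ := ho
  omega

theorem IsProperColoring.colorable {V : Type} {G : SimpleGraph V} {k : ℕ} {ζ : V → ℕ}
    (h : IsProperColoring G k ζ) : G.Colorable k :=
  ⟨SimpleGraph.Coloring.mk (fun v => (⟨ζ v - 1, by have := h.1 v; omega⟩ : Fin k)) fun {a b} hab e => by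
    have := h.2 hab
    have := h.1 a
    have := h.1 b
    simp only [Fin.mk.injEq] at e
    omega⟩

theorem chi_eq_of_colorable {V : Type} {G : SimpleGraph V} {k : ℕ} (h : G.Colorable (k + 1))
    (h' : ¬ G.Colorable k) : chi G = k + 1 := by
  have : G.chromaticNumber = ((k + 1 : ℕ) : ℕ∞) := by
    refine le_antisymm h.chromaticNumber_le ?_
    by_contra hlt
    refine h' (SimpleGraph.chromaticNumber_le_iff_colorable.1 ?_)
    rw [not_le] at hlt
    exact Order.le_of_lt_add_one (by exact_mod_cast hlt)
  rw [chi, this, ENat.toNat_natCast]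

/-- The coloring of the sunflower graph by `1` on `u` and all `vᵢ`, and by `c` on the cycle. -/
def cycleColoring {n : ℕ} (c : Fin n → ℕ) : GV n → ℕ
  | none => 1
  | some (Sum.inl i) => c i
  | some (Sum.inr _) => 1

theorem isProperColoring_cycleColoring {n k : ℕ} [NeZero n] (hn : 2 ≤ n) {c : Fin n → ℕ}
    (hc : ∀ i, 2 ≤ c i ∧ c i ≤ k) (hne : ∀ i, c i ≠ c (i + 1)) :
    IsProperColoring (sunflowerGraph n) k (cycleColoring c) := by
  have hk := hc 0
  refine ⟨?_, (sunflowerGraph_ne_iff hn _).2 fun i => ?_⟩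
  · rintro (_ | i | i)
    · simp only [cycleColoring]; omega
    · have := hc i
      simp only [cycleColoring]; omega
    · simp only [cycleColoring]; omega
  · have := hc i
    have := hc (i + 1)
    have := hne i
    simp only [cycleColoring]
    omega

theorem M1_eq {n : ℕ} (ζ : GV n → ℕ) :
    M1 ζ = ((ζ none ^ 2 + (∑ i : Fin n, ζ (some (Sum.inl i)) ^ 2 +
      ∑ i : Fin n, ζ (some (Sum.inr i)) ^ 2) : ℕ) : ℚ) := by
  simp [M1, Fintype.sum_option, Fintype.sum_sum_type]

theorem two_mul_sum_sq_eq {n : ℕ} [NeZero n] (c w : Fin n → ℕ) :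
    2 * (∑ i, c i ^ 2 + ∑ i, w i ^ 2) = ∑ i, (2 * w i ^ 2 + c i ^ 2 + c (i + 1) ^ 2) := by
  rw [Finset.sum_add_distrib, Finset.sum_add_distrib, sum_add_one (fun i => c i ^ 2),
    ← Finset.mul_sum]
  ring

theorem sum_range_alternating (m : ℕ) : ∑ i ∈ range (2 * m), (2 + i % 2) ^ 2 = 13 * m := by
  induction m with
  | zero => rfl
  | succ m ih =>
    rw [Nat.mul_succ, Finset.sum_range_succ, Finset.sum_range_succ, ih,
      show 2 * m % 2 = 0 by omega, show (2 * m + 1) % 2 = 1 by omega]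
    ring

theorem fifteen_le_of_distinct {a b w : ℕ} (ha : 1 ≤ a) (hb : 1 ≤ b) (hw : 1 ≤ w) (hab : a ≠ b)
    (hwa : w ≠ a) (hwb : w ≠ b) : 15 ≤ 2 * w ^ 2 + a ^ 2 + b ^ 2 := by
  by_cases h : a < 4 ∧ b < 4 ∧ w < 4
  · obtain ⟨h1, h2, h3⟩ := h
    interval_cases a <;> interval_cases b <;> interval_cases w <;> omega
  · have : 4 ≤ a ∨ 4 ≤ b ∨ 4 ≤ w := by omega
    rcases this with h | h | h <;> nlinarith

set_option synthInstance.maxSize 1000 in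
set_option synthInstance.maxHeartbeats 200000 in
theorem fifteen_mul_le_of_odd {n : ℕ} [NeZero n] (hn : 3 ≤ n) (ho : Odd n) (u : ℕ)
    (c w : Fin n → ℕ) (hu : 1 ≤ u ∧ u ≤ 4) (hc : ∀ i, 1 ≤ c i ∧ c i ≤ 4)
    (hw : ∀ i, 1 ≤ w i ∧ w i ≤ 4) (huc : ∀ i, u ≠ c i) (hcc : ∀ i, c i ≠ c (i + 1))
    (hwc : ∀ i, w i ≠ c i) (hwc' : ∀ i, w i ≠ c (i + 1)) :
    15 * n + 21 ≤ 2 * (u ^ 2 + (∑ i, c i ^ 2 + ∑ i, w i ^ 2)) := by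
  rw [mul_add, two_mul_sum_sq_eq]
  have key := two_mul_sum_ite_le c hcc
  have bound (A p q x y : ℕ)
      (h : ∀ a < 5, ∀ b < 5, ∀ v < 5, 1 ≤ a ∧ 1 ≤ b ∧ 1 ≤ v ∧ u ≠ a ∧ u ≠ b ∧ a ≠ b ∧
        v ≠ a ∧ v ≠ b → A ≤ 2 * v ^ 2 + a ^ 2 + b ^ 2 +
          (p * ((if a = x then 1 else 0) + (if b = x then 1 else 0)) +
            q * ((if a = y then 1 else 0) + (if b = y then 1 else 0)))) :
      n * A ≤ ∑ i, (2 * w i ^ 2 + c i ^ 2 + c (i + 1) ^ 2) +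
        (p * (2 * ∑ i, (if c i = x then 1 else 0)) +
          q * (2 * ∑ i, (if c i = y then 1 else 0))) := by
    have hs := Finset.sum_le_sum fun i (_ : i ∈ (univ : Finset (Fin n))) =>
      h (c i) (Nat.lt_succ_of_le (hc i).2) (c (i + 1)) (Nat.lt_succ_of_le (hc _).2)
        (w i) (Nat.lt_succ_of_le (hw i).2) ⟨(hc i).1, (hc _).1, (hw i).1, huc i,
        huc _, hcc i, hwc i, hwc' i⟩
    rw [Finset.sum_add_distrib, Finset.sum_add_distrib (f := fun i => p * _), ← Finset.mul_sum,
      ← Finset.mul_sum, Finset.sum_add_distrib (f := fun i => if c i = x then 1 else 0),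
      Finset.sum_add_distrib (f := fun i => if c i = y then 1 else 0),
      sum_add_one (fun i => if c i = x then 1 else 0),
      sum_add_one (fun i => if c i = y then 1 else 0)] at hs
    simp only [Finset.sum_const, Finset.card_univ, Fintype.card_fin, smul_eq_mul, ← two_mul] at hs
    exact hs
  obtain ⟨m, hm⟩ := ho
  obtain ⟨hu1, hu4⟩ := hu
  interval_cases u
  · have := bound 34 12 7 2 3 (by decide)
    have := key 2
    have := key 3
    omega
  · have := bound 32 7 7 1 3 (by decide)
    have := key 1
    have := key 3
    omega
  · have := bound 22 0 0 0 0 (by decide)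
    omega
  · have := bound 15 0 0 0 0 (by decide)
    omega

theorem Fin.val_add_one_eq_ite {n : ℕ} [NeZero n] (i : Fin n) :
    (i + 1).val = if i.val + 1 = n then 0 else i.val + 1 := by
  rw [Fin.val_add, Fin.val_one', Nat.add_mod_mod]
  split_ifs with h
  · rw [h, Nat.mod_self]
  · exact Nat.mod_eq_of_lt (by omega)

theorem exists_isProperColoring_of_even {n : ℕ} (hn : 3 ≤ n) (he : Even n) :
    ∃ ζ : GV n → ℕ, IsProperColoring (sunflowerGraph n) 3 ζ ∧ (15 * (n : ℚ) + 2) / 2 = M1 ζ := by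
  have : NeZero n := ⟨by omega⟩
  obtain ⟨m, hm⟩ := he.exists_two_nsmul
  rw [smul_eq_mul] at hm
  refine ⟨cycleColoring fun i => 2 + i.val % 2,
    isProperColoring_cycleColoring (by omega) (fun i => by omega) fun i => ?_, ?_⟩
  · rw [Fin.val_add_one_eq_ite]
    split_ifs <;> omega
  · rw [M1_eq]
    simp only [cycleColoring]
    rw [Fin.sum_univ_eq_sum_range (fun i => (2 + i % 2) ^ 2), hm, sum_range_alternating]
    simp only [one_pow, Finset.sum_const, Finset.card_univ, Fintype.card_fin, smul_eq_mul]
    push_cast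
    ring

theorem exists_isProperColoring_of_odd {n : ℕ} (hn : 3 ≤ n) (ho : Odd n) :
    ∃ ζ : GV n → ℕ, IsProperColoring (sunflowerGraph n) 4 ζ ∧ (15 * (n : ℚ) + 21) / 2 = M1 ζ := by
  have : NeZero n := ⟨by omega⟩
  obtain ⟨m, hm⟩ := ho
  refine ⟨cycleColoring fun i => if i.val = 2 * m then 4 else 2 + i.val % 2,
    isProperColoring_cycleColoring (by omega) (fun i => by split_ifs <;> omega) fun i => ?_, ?_⟩
  · rw [Fin.val_add_one_eq_ite]
    split_ifs <;> omega
  · rw [M1_eq]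
    simp only [cycleColoring]
    rw [Fin.sum_univ_eq_sum_range (fun i => (if i = 2 * m then 4 else 2 + i % 2) ^ 2), hm,
      Finset.sum_range_succ, if_pos rfl]
    have h : ∑ i ∈ range (2 * m), (if i = 2 * m then 4 else 2 + i % 2) ^ 2 = 13 * m := by
      rw [← sum_range_alternating]
      refine Finset.sum_congr rfl fun i hi => ?_
      rw [if_neg (Finset.mem_range.1 hi).ne]
    rw [h]
    simp only [one_pow, Finset.sum_const, Finset.card_univ, Fintype.card_fin, smul_eq_mul]
    push_cast
    ring

theorem sunflower_M1_min (n : ℕ) (hn : 3 ≤ n) :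
    (Even n → IsLeast {x : ℚ | ∃ ζ : GV n → ℕ,
        IsProperColoring (sunflowerGraph n) (chi (sunflowerGraph n)) ζ ∧ x = M1 ζ}
      ((15 * (n : ℚ) + 2) / 2)) ∧
    (Odd n → IsLeast {x : ℚ | ∃ ζ : GV n → ℕ,
        IsProperColoring (sunflowerGraph n) (chi (sunflowerGraph n)) ζ ∧ x = M1 ζ}
      ((15 * (n : ℚ) + 21) / 2)) := by
  have : NeZero n := ⟨by omega⟩
  refine ⟨fun he => ?_, fun ho => ?_⟩
  · obtain ⟨ζ, hζ, hM⟩ := exists_isProperColoring_of_even hn he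
    rw [chi_eq_of_colorable hζ.colorable (sunflowerGraph_not_colorable_two hn)]
    refine ⟨⟨ζ, hζ, hM⟩, ?_⟩
    rintro _ ⟨ξ, ⟨hξ, hne⟩, rfl⟩
    rw [sunflowerGraph_ne_iff (by omega)] at hne
    have hs := Finset.sum_le_sum fun i (_ : i ∈ (univ : Finset (Fin n))) =>
      fifteen_le_of_distinct (hξ (some (Sum.inl i))).1 (hξ (some (Sum.inl (i + 1)))).1
        (hξ (some (Sum.inr i))).1 (hne i).2.1 (hne i).2.2.1 (hne i).2.2.2
    rw [← two_mul_sum_sq_eq (fun i => ξ (some (Sum.inl i))) (fun i => ξ (some (Sum.inr i)))] at hs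
    simp only [Finset.sum_const, Finset.card_univ, Fintype.card_fin, smul_eq_mul] at hs
    have hu : 1 ≤ ξ none ^ 2 := Nat.one_le_pow _ _ (hξ none).1
    rw [M1_eq, div_le_iff₀ two_pos]
    exact_mod_cast (by omega)
  · obtain ⟨ζ, hζ, hM⟩ := exists_isProperColoring_of_odd hn ho
    rw [chi_eq_of_colorable hζ.colorable (sunflowerGraph_not_colorable_three hn ho)]
    refine ⟨⟨ζ, hζ, hM⟩, ?_⟩
    rintro _ ⟨ξ, ⟨hξ, hne⟩, rfl⟩
    rw [sunflowerGraph_ne_iff (by omega)] at hne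
    have hs := fifteen_mul_le_of_odd hn ho (ξ none) (fun i => ξ (some (Sum.inl i)))
      (fun i => ξ (some (Sum.inr i))) (hξ _) (fun i => hξ _) (fun i => hξ _) (fun i => (hne i).1)
      (fun i => (hne i).2.1) (fun i => (hne i).2.2.1) (fun i => (hne i).2.2.2)
    rw [M1_eq, div_le_iff₀' two_pos]
    exact_mod_cast hs
end

section
/- Let n ≥ 3. For the sunflower graph SF_n, the minimum second chromatic Zagreb index satisfies M₂^{φ−}(SF_n) = 27n/2 if n is even, and M₂^{φ−}(SF_n) = (27n + 25)/2 if n is odd. -/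
open Finset

/-- The second chromatic Zagreb index: `∑_{uv ∈ E(G)} ζ(u)·ζ(v)`. -/
noncomputable def M2 {V : Type} [Fintype V] [DecidableEq V] (G : SimpleGraph V)
    (ζ : V → ℕ) : ℚ :=
  letI : DecidableRel G.Adj := fun a b => Classical.dec _
  ∑ e ∈ G.edgeFinset, Sym2.lift ⟨fun a b => (ζ a : ℚ) * ζ b, fun _ _ => mul_comm _ _⟩ e

namespace SunflowerZagreb

/-- The cyclic successor on `Fin n`. -/
def next {n : ℕ} (i : Fin n) : Fin n := ⟨(i + 1) % n, Nat.mod_lt _ (Nat.zero_lt_of_lt i.isLt)⟩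

lemma nextIdx_iff {n : ℕ} {i j : Fin n} : NextIdx i j ↔ j = next i := by
  simp [NextIdx, next, Fin.ext_iff]

lemma next_val {n : ℕ} (i : Fin n) :
    ((next i : Fin n) : ℕ) = if (i : ℕ) + 1 = n then 0 else (i : ℕ) + 1 := by
  have := i.isLt
  split_ifs with h
  · simp [next, h]
  · exact Nat.mod_eq_of_lt (by omega)

lemma next_injective {n : ℕ} : Function.Injective (next : Fin n → Fin n) := by
  intro i j h
  have h' := congrArg Fin.val h
  rw [next_val, next_val] at h'
  ext
  split_ifs at h' <;> omega

lemma next_ne {n : ℕ} (hn : 3 ≤ n) (i : Fin n) : next i ≠ i := by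
  intro h
  have h' := congrArg Fin.val h
  rw [next_val] at h'
  split_ifs at h' <;> omega

lemma next_next_ne {n : ℕ} (hn : 3 ≤ n) (i : Fin n) : next (next i) ≠ i := by
  intro h
  have h' := congrArg Fin.val h
  rw [next_val, next_val] at h'
  split_ifs at h' <;> omega

lemma sum_comp_next {n : ℕ} (f : Fin n → ℕ) : ∑ i, f (next i) = ∑ i, f i :=
  (Finite.injective_iff_bijective.mp next_injective).sum_comp f

/-- A subset of an odd cycle contains both or none of the ends of some edge. -/
lemma exists_iff_next {n : ℕ} (hn : Odd n) (P : Fin n → Prop) : ∃ i, P i ↔ P (next i) := by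
  by_contra! h
  have hpos := hn.pos
  have key : ∀ k : ℕ, P ⟨k % n, Nat.mod_lt _ hpos⟩ ↔ (P ⟨0, hpos⟩ ↔ Even k) := by
    intro k
    induction k with
    | zero => simp
    | succ k ih =>
      have hk := h ⟨k % n, Nat.mod_lt _ hpos⟩
      have e : next ⟨k % n, Nat.mod_lt _ hpos⟩ = (⟨(k + 1) % n, Nat.mod_lt _ hpos⟩ : Fin n) := by
        simp [next]
      rw [e] at hk
      rw [Nat.even_add_one]
      tauto
  have hlast := key n
  simp only [Nat.mod_self] at hlast
  have := Nat.not_even_iff_odd.mpr hn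
  tauto

/-- A proper coloring of an odd cycle has, for each color `x`, an edge avoiding `x`. -/
lemma exists_edge_avoiding {n : ℕ} (hn : Odd n) {f : Fin n → ℕ} (hf : ∀ i, f i ≠ f (next i))
    (x : ℕ) : ∃ i, f i ≠ x ∧ f (next i) ≠ x := by
  obtain ⟨i, hi⟩ := exists_iff_next hn (fun i => f i = x)
  refine ⟨i, fun h => hf i (h.trans (hi.mp h).symm), fun h => hf i ((hi.mpr h).trans h.symm)⟩

lemma isProperColoring_iff {n : ℕ} (hn : 3 ≤ n) (k : ℕ) (ζ : GV n → ℕ) :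
    IsProperColoring (sunflowerGraph n) k ζ ↔
      (∀ v, 1 ≤ ζ v ∧ ζ v ≤ k) ∧ ∀ i,
        ζ (some (Sum.inl i)) ≠ ζ (some (Sum.inl (next i))) ∧
        ζ none ≠ ζ (some (Sum.inl i)) ∧
        ζ (some (Sum.inr i)) ≠ ζ (some (Sum.inl i)) ∧
        ζ (some (Sum.inr i)) ≠ ζ (some (Sum.inl (next i))) := by
  unfold IsProperColoring
  refine and_congr_right fun _ => ⟨fun h i => ⟨h ?_, h ?_, h ?_, h ?_⟩, fun h a b hab => ?_⟩
  · simpa [sunflowerGraph, nextIdx_iff] using (next_ne hn i).symm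
  · simp [sunflowerGraph, nextIdx_iff]
  · simp [sunflowerGraph, nextIdx_iff]
  · simp [sunflowerGraph, nextIdx_iff]
  · simp only [sunflowerGraph, SimpleGraph.fromRel_adj, nextIdx_iff] at hab
    obtain ⟨-, (⟨i, j, rfl, rfl, rfl⟩ | ⟨i, rfl, rfl⟩ | ⟨i, rfl, rfl⟩ | ⟨i, j, rfl, rfl, rfl⟩) |
      (⟨i, j, rfl, rfl, rfl⟩ | ⟨i, rfl, rfl⟩ | ⟨i, rfl, rfl⟩ | ⟨i, j, rfl, rfl, rfl⟩)⟩ := hab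
    · exact (h i).1
    · exact (h i).2.1
    · exact (h i).2.2.1
    · exact (h i).2.2.2
    · exact (h i).1.symm
    · exact (h i).2.1.symm
    · exact (h i).2.2.1.symm
    · exact (h i).2.2.2.symm

lemma colorable_iff_exists_isProperColoring {V : Type} (G : SimpleGraph V) (k : ℕ) :
    G.Colorable k ↔ ∃ ζ, IsProperColoring G k ζ := by
  constructor
  · rintro ⟨C⟩
    refine ⟨fun v => (C v : ℕ) + 1, fun v => ⟨Nat.le_add_left 1 _, (C v).isLt⟩,
      fun a b hab h => ?_⟩
    exact C.valid hab (Fin.ext (by simpa using h))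
  · rintro ⟨ζ, hb, hζ⟩
    refine ⟨SimpleGraph.Coloring.mk
      (fun v => (⟨ζ v - 1, Nat.sub_one_lt_of_le (hb v).1 (hb v).2⟩ : Fin k))
      fun {a b} hab h => hζ hab ?_⟩
    have := hb a
    have := hb b
    have := congrArg Fin.val h
    simp only at this
    omega

/-- The four edges of the sunflower graph belonging to the index `i`. -/
def edge {n : ℕ} (p : Fin n × Fin 4) : Sym2 (GV n) :=
  ![s(some (Sum.inl p.1), some (Sum.inl (next p.1))), s(none, some (Sum.inl p.1)),
    s(some (Sum.inr p.1), some (Sum.inl p.1)), s(some (Sum.inr p.1), some (Sum.inl (next p.1)))] p.2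

lemma edge_injective {n : ℕ} (hn : 3 ≤ n) : Function.Injective (edge : Fin n × Fin 4 → _) := by
  rintro ⟨i, a⟩ ⟨j, b⟩ h
  have h1 := next_ne hn i
  have h2 := next_next_ne hn i
  have h3 := next_ne hn j
  have h4 := next_next_ne hn j
  have h5 := @next_injective n i j
  fin_cases a <;> fin_cases b <;> simp [edge] at h ⊢ <;> grind

lemma edgeSet_eq {n : ℕ} (hn : 3 ≤ n) :
    (sunflowerGraph n).edgeSet = Set.range (edge : Fin n × Fin 4 → _) := by
  ext e
  induction e using Sym2.ind with
  | _ a b =>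
    simp only [SimpleGraph.mem_edgeSet, Set.mem_range, Prod.exists, sunflowerGraph,
      SimpleGraph.fromRel_adj, nextIdx_iff]
    constructor
    · rintro ⟨-, (⟨i, j, rfl, rfl, rfl⟩ | ⟨i, rfl, rfl⟩ | ⟨i, rfl, rfl⟩ | ⟨i, j, rfl, rfl, rfl⟩) |
        (⟨i, j, rfl, rfl, rfl⟩ | ⟨i, rfl, rfl⟩ | ⟨i, rfl, rfl⟩ | ⟨i, j, rfl, rfl, rfl⟩)⟩
      · exact ⟨i, 0, rfl⟩
      · exact ⟨i, 1, rfl⟩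
      · exact ⟨i, 2, rfl⟩
      · exact ⟨i, 3, rfl⟩
      · exact ⟨i, 0, Sym2.eq_swap⟩
      · exact ⟨i, 1, Sym2.eq_swap⟩
      · exact ⟨i, 2, Sym2.eq_swap⟩
      · exact ⟨i, 3, Sym2.eq_swap⟩
    · rintro ⟨i, k, h⟩
      have h1 := next_ne hn i
      fin_cases k <;> simp [edge] at h <;> rcases h with ⟨rfl, rfl⟩ | ⟨rfl, rfl⟩ <;>
        simp [h1, h1.symm]

/-- Twice the contribution of the `i`-th sector, the spokes being shared by adjacent sectors. -/
def sectorWeight {n : ℕ} (ζ : GV n → ℕ) (i : Fin n) : ℕ :=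
  2 * (ζ (some (Sum.inl i)) * ζ (some (Sum.inl (next i)))) +
    (ζ none + 2 * ζ (some (Sum.inr i))) * (ζ (some (Sum.inl i)) + ζ (some (Sum.inl (next i))))

lemma two_mul_M2 {n : ℕ} (hn : 3 ≤ n) (ζ : GV n → ℕ) :
    2 * M2 (sunflowerGraph n) ζ = ((∑ i, sectorWeight ζ i : ℕ) : ℚ) := by
  classical
  have hset : ∀ (inst : Fintype (sunflowerGraph n).edgeSet),
      @SimpleGraph.edgeFinset _ (sunflowerGraph n) inst = univ.image edge := by
    intro inst
    ext e
    rw [SimpleGraph.mem_edgeFinset, edgeSet_eq hn]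
    simp
  have hM : M2 (sunflowerGraph n) ζ = ((∑ i : Fin n,
      (ζ (some (Sum.inl i)) * ζ (some (Sum.inl (next i))) + ζ none * ζ (some (Sum.inl i)) +
        ζ (some (Sum.inr i)) * ζ (some (Sum.inl i)) +
        ζ (some (Sum.inr i)) * ζ (some (Sum.inl (next i)))) : ℕ) : ℚ) := by
    unfold M2
    rw [hset, Finset.sum_image (edge_injective hn).injOn, Fintype.sum_prod_type]
    simp [Fin.sum_univ_four, edge]
  rw [hM]
  norm_cast
  have hs := sum_comp_next (fun i => ζ none * ζ (some (Sum.inl i)))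
  have hw : ∑ i, sectorWeight ζ i = ∑ i : Fin n,
      (2 * (ζ (some (Sum.inl i)) * ζ (some (Sum.inl (next i))) +
        ζ (some (Sum.inr i)) * ζ (some (Sum.inl i)) +
        ζ (some (Sum.inr i)) * ζ (some (Sum.inl (next i)))) +
        ζ none * ζ (some (Sum.inl i))) + ∑ i, ζ none * ζ (some (Sum.inl (next i))) := by
    rw [← Finset.sum_add_distrib]
    exact Finset.sum_congr rfl fun i _ => by unfold sectorWeight; ring
  rw [hw, hs, ← Finset.sum_add_distrib, Finset.mul_sum]
  exact Finset.sum_congr rfl fun i _ => by ring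

lemma sector_bound {a b c v : ℕ} (ha : 1 ≤ a ∧ a ≤ 4) (hb : 1 ≤ b ∧ b ≤ 4) (hc : 1 ≤ c ∧ c ≤ 4)
    (hv : 1 ≤ v ∧ v ≤ 4) (hab : a ≠ b) (hca : c ≠ a) (hcb : c ≠ b) (hva : v ≠ a) (hvb : v ≠ b) :
    27 ≤ 2 * (a * b) + (c + 2 * v) * (a + b) ∧
    (c = 1 → 27 + (if a ≠ 2 ∧ b ≠ 2 then 18 else 0) + (if a ≠ 3 ∧ b ≠ 3 then 7 else 0) ≤
      2 * (a * b) + (c + 2 * v) * (a + b)) ∧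
    (c = 2 → 30 + (if a ≠ 1 ∧ b ≠ 1 then 22 else 0) + (if a ≠ 3 ∧ b ≠ 3 then 8 else 0) ≤
      2 * (a * b) + (c + 2 * v) * (a + b)) ∧
    (c = 3 → 31 + (if a ≠ 1 ∧ b ≠ 1 then 15 else 0) + (if a ≠ 2 ∧ b ≠ 2 then 12 else 0) ≤
      2 * (a * b) + (c + 2 * v) * (a + b)) ∧
    (c = 4 → 34 + (if a ≠ 1 ∧ b ≠ 1 then 8 else 0) + (if a ≠ 2 ∧ b ≠ 2 then 4 else 0) ≤
      2 * (a * b) + (c + 2 * v) * (a + b)) := by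
  obtain ⟨ha1, ha4⟩ := ha
  obtain ⟨hb1, hb4⟩ := hb
  obtain ⟨hc1, hc4⟩ := hc
  obtain ⟨hv1, hv4⟩ := hv
  interval_cases a <;> interval_cases b <;> first | omega | skip
  all_goals interval_cases c <;> first | omega | skip
  all_goals interval_cases v <;> first | omega | simp

lemma le_sum_of_penalties {n : ℕ} (w : Fin n → ℕ) (base d e : ℕ) (P Q : Fin n → Prop)
    [DecidablePred P] [DecidablePred Q] (hP : ∃ i, P i) (hQ : ∃ i, Q i)
    (h : ∀ i, base + (if P i then d else 0) + (if Q i then e else 0) ≤ w i) :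
    n * base + d + e ≤ ∑ i, w i := by
  have single : ∀ (R : Fin n → Prop) [DecidablePred R] (m : ℕ), (∃ i, R i) →
      m ≤ ∑ i, if R i then m else 0 := by
    rintro R _ m ⟨i, hi⟩
    have := Finset.single_le_sum (f := fun i => if R i then m else 0)
      (fun j _ => Nat.zero_le _) (mem_univ i)
    simpa [hi] using this
  have hsum := Finset.sum_le_sum fun i (_ : i ∈ univ) => h i
  simp only [Finset.sum_add_distrib, Finset.sum_const, card_univ, Fintype.card_fin,
    smul_eq_mul] at hsum
  have := single P d hP
  have := single Q e hQ
  omega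

lemma sum_sectorWeight_ge {n k : ℕ} (hn : 3 ≤ n) (hk : k ≤ 4) {ζ : GV n → ℕ}
    (h : IsProperColoring (sunflowerGraph n) k ζ) :
    27 * n ≤ ∑ i, sectorWeight ζ i ∧ (Odd n → 27 * n + 25 ≤ ∑ i, sectorWeight ζ i) := by
  rw [isProperColoring_iff hn] at h
  obtain ⟨hb, hp⟩ := h
  have hb' : ∀ v, 1 ≤ ζ v ∧ ζ v ≤ 4 := fun v => ⟨(hb v).1, (hb v).2.trans hk⟩
  have key := fun i => sector_bound (hb' (some (Sum.inl i))) (hb' (some (Sum.inl (next i))))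
    (hb' none) (hb' (some (Sum.inr i))) (hp i).1 (hp i).2.1 (hp (next i)).2.1 (hp i).2.2.1
    (hp i).2.2.2
  constructor
  · have := Finset.sum_le_sum fun i (_ : i ∈ univ) => (key i).1
    simpa [sectorWeight, mul_comm] using this
  · intro ho
    have hav := exists_edge_avoiding ho (fun i => (hp i).1)
    have hc := hb' none
    obtain hc | hc | hc | hc : ζ none = 1 ∨ ζ none = 2 ∨ ζ none = 3 ∨ ζ none = 4 := by omega
    · have := le_sum_of_penalties (sectorWeight ζ) 27 18 7 _ _ (hav 2) (hav 3)
        fun i => (key i).2.1 hc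
      omega
    · have := le_sum_of_penalties (sectorWeight ζ) 30 22 8 _ _ (hav 1) (hav 3)
        fun i => (key i).2.2.1 hc
      omega
    · have := le_sum_of_penalties (sectorWeight ζ) 31 15 12 _ _ (hav 1) (hav 2)
        fun i => (key i).2.2.2.1 hc
      omega
    · have := le_sum_of_penalties (sectorWeight ζ) 34 8 4 _ _ (hav 1) (hav 2)
        fun i => (key i).2.2.2.2 hc
      omega

/-- Center and outer vertices get color `1`; the rim alternates `2, 3, 2, 3, …`, except that the
last rim vertex gets color `4` when `n` is odd. -/
def optimalColoring (n : ℕ) : GV n → ℕ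
  | none => 1
  | some (Sum.inl i) => if Odd n ∧ (i : ℕ) + 1 = n then 4 else if Even (i : ℕ) then 2 else 3
  | some (Sum.inr _) => 1

lemma optimalColoring_proper_even {n : ℕ} (hn : 3 ≤ n) (he : Even n) :
    IsProperColoring (sunflowerGraph n) 3 (optimalColoring n) := by
  rw [isProperColoring_iff hn]
  refine ⟨?_, fun i => ?_⟩
  · rintro (_ | i | i) <;> simp only [optimalColoring] <;> grind
  · have := next_val i
    simp only [optimalColoring]
    grind

lemma optimalColoring_proper_odd {n : ℕ} (hn : 3 ≤ n) (ho : Odd n) :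
    IsProperColoring (sunflowerGraph n) 4 (optimalColoring n) := by
  rw [isProperColoring_iff hn]
  refine ⟨?_, fun i => ?_⟩
  · rintro (_ | i | i) <;> simp only [optimalColoring] <;> grind
  · have := next_val i
    simp only [optimalColoring]
    grind

lemma sum_optimalColoring_even {n : ℕ} (he : Even n) :
    ∑ i, sectorWeight (optimalColoring n) i = 27 * n := by
  have : ∀ i : Fin n, sectorWeight (optimalColoring n) i = 27 := by
    intro i
    have := next_val i
    simp only [sectorWeight, optimalColoring]
    grind
  simp [this, mul_comm]

lemma sum_optimalColoring_odd {n : ℕ} (hn : 3 ≤ n) (ho : Odd n) :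
    ∑ i, sectorWeight (optimalColoring n) i = 27 * n + 25 := by
  have : ∀ i : Fin n, sectorWeight (optimalColoring n) i =
      27 + (if i = ⟨n - 2, by omega⟩ then 18 else 0) +
        (if i = ⟨n - 1, by omega⟩ then 7 else 0) := by
    intro i
    have := next_val i
    simp only [sectorWeight, optimalColoring, Fin.ext_iff]
    grind
  simp only [this, Finset.sum_add_distrib, Finset.sum_ite_eq', mem_univ, if_true]
  simp
  omega

lemma three_le_of_isProperColoring {n k : ℕ} (hn : 3 ≤ n) {ζ : GV n → ℕ}
    (h : IsProperColoring (sunflowerGraph n) k ζ) : 3 ≤ k := by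
  rw [isProperColoring_iff hn] at h
  obtain ⟨hb, hp⟩ := h
  have i : Fin n := ⟨0, by omega⟩
  have := hb none
  have := hb (some (Sum.inl i))
  have := hb (some (Sum.inl (next i)))
  have := hp i
  have := hp (next i)
  omega

lemma four_le_of_isProperColoring {n k : ℕ} (hn : 3 ≤ n) (ho : Odd n) {ζ : GV n → ℕ}
    (h : IsProperColoring (sunflowerGraph n) k ζ) : 4 ≤ k := by
  rw [isProperColoring_iff hn] at h
  obtain ⟨hb, hp⟩ := h
  obtain ⟨j, hj⟩ := exists_edge_avoiding ho (fun i => (hp i).1) (if ζ none = 1 then 2 else 1)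
  have := hb none
  have := hb (some (Sum.inl j))
  have := hb (some (Sum.inl (next j)))
  have := hp j
  have := hp (next j)
  split_ifs at hj <;> omega

lemma chi_eq {V : Type} {G : SimpleGraph V} {k : ℕ} {ζ : V → ℕ} (h : IsProperColoring G k ζ)
    (hmin : ∀ m (ξ : V → ℕ), IsProperColoring G m ξ → k ≤ m) : chi G = k := by
  have : G.chromaticNumber = k := by
    refine le_antisymm
      ((colorable_iff_exists_isProperColoring G k).mpr ⟨ζ, h⟩).chromaticNumber_le ?_
    rw [SimpleGraph.le_chromaticNumber_iff_colorable]
    intro m hm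
    obtain ⟨ξ, hξ⟩ := (colorable_iff_exists_isProperColoring G m).mp hm
    exact hmin m ξ hξ
  simp [chi, this]

end SunflowerZagreb

theorem sunflower_M2_min (n : ℕ) (hn : 3 ≤ n) :
    (Even n → IsLeast {x : ℚ | ∃ ζ : GV n → ℕ,
        IsProperColoring (sunflowerGraph n) (chi (sunflowerGraph n)) ζ ∧ x = M2 (sunflowerGraph n) ζ}
      (27 * (n : ℚ) / 2)) ∧
    (Odd n → IsLeast {x : ℚ | ∃ ζ : GV n → ℕ,
        IsProperColoring (sunflowerGraph n) (chi (sunflowerGraph n)) ζ ∧ x = M2 (sunflowerGraph n) ζ}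
      ((27 * (n : ℚ) + 25) / 2)) := by
  open SunflowerZagreb in
  constructor
  · intro he
    rw [chi_eq (optimalColoring_proper_even hn he) fun _ _ => three_le_of_isProperColoring hn]
    constructor
    · refine ⟨_, optimalColoring_proper_even hn he, ?_⟩
      have h := two_mul_M2 hn (optimalColoring n)
      rw [sum_optimalColoring_even he] at h
      push_cast at h
      linarith
    · rintro _ ⟨ζ, hζ, rfl⟩
      have h : ((27 * n : ℕ) : ℚ) ≤ _ :=
        Nat.cast_le.mpr (sum_sectorWeight_ge hn (by norm_num) hζ).1
      rw [← two_mul_M2 hn] at h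
      push_cast at h
      linarith
  · intro ho
    rw [chi_eq (optimalColoring_proper_odd hn ho) fun _ _ => four_le_of_isProperColoring hn ho]
    constructor
    · refine ⟨_, optimalColoring_proper_odd hn ho, ?_⟩
      have h := two_mul_M2 hn (optimalColoring n)
      rw [sum_optimalColoring_odd hn ho] at h
      push_cast at h
      linarith
    · rintro _ ⟨ζ, hζ, rfl⟩
      have h : ((27 * n + 25 : ℕ) : ℚ) ≤ _ :=
        Nat.cast_le.mpr ((sum_sectorWeight_ge hn le_rfl hζ).2 ho)
      rw [← two_mul_M2 hn] at h
      push_cast at h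
      linarith
end
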